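/- Let k be a field containing a primitive n-th root of unity ζ, n ≥ 2 invertible in k, and K a field extension of k. The symbol algebra (a,b)_{ζ,n} over K, generated by x₁, x₂ with x₁ⁿ = a, x₂ⁿ = b, x₁x₂ = ζ x₂x₁ (a, b ∈ K*), is a central simple K-algebra of dimension n². -/

import Mathlib

open FreeAlgebra

/-- The defining relations of the symbol algebra `(a, b)_{ζ,n}` over `K`:
`x₁ⁿ = a`, `x₂ⁿ = b`, `x₁x₂ = ζ x₂x₁`. -/
inductive SymbolRel (K : Type*) [Field K] (n : ℕ) (ζ a b : K) :
    FreeAlgebra K (Fin 2) → FreeAlgebra K (Fin 2) → Prop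
  | x_pow : SymbolRel K n ζ a b (ι K (0 : Fin 2) ^ n) (algebraMap K _ a)
  | y_pow : SymbolRel K n ζ a b (ι K (1 : Fin 2) ^ n) (algebraMap K _ b)
  | comm : SymbolRel K n ζ a b (ι K (0 : Fin 2) * ι K (1 : Fin 2))
      (algebraMap K _ ζ * (ι K (1 : Fin 2) * ι K (0 : Fin 2)))

/-- The symbol algebra `(a, b)_{ζ,n}` over `K`, generated by `x₁, x₂` with
`x₁ⁿ = a`, `x₂ⁿ = b`, `x₁x₂ = ζ x₂x₁`. -/
def SymbolAlgebra (K : Type*) [Field K] (n : ℕ) (ζ a b : K) :=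
  RingQuot (SymbolRel K n ζ a b)

noncomputable instance (K : Type*) [Field K] (n : ℕ) (ζ a b : K) :
    Ring (SymbolAlgebra K n ζ a b) :=
  inferInstanceAs (Ring (RingQuot (SymbolRel K n ζ a b)))

noncomputable instance (K : Type*) [Field K] (n : ℕ) (ζ a b : K) :
    Algebra K (SymbolAlgebra K n ζ a b) :=
  inferInstanceAs (Algebra K (RingQuot (SymbolRel K n ζ a b)))

universe u

namespace SymAux

section
variable {K A : Type*} [Field K] [Ring A] [Algebra K A]

lemma sc_pow_left {X z : A} {c : K} (h : X * z = c • (z * X)) (k : ℕ) :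
    X ^ k * z = c ^ k • (z * X ^ k) := by
  induction k with
  | zero => simp
  | succ k ih =>
    rw [pow_succ, mul_assoc, h, mul_smul_comm, ← mul_assoc, ih, smul_mul_assoc, smul_smul,
      mul_assoc, ← pow_succ, ← pow_succ']

lemma sc_mul {X z w : A} {c d : K} (h : X * z = c • (z * X)) (h' : X * w = d • (w * X)) :
    X * (z * w) = (c * d) • ((z * w) * X) := by
  rw [← mul_assoc, h, smul_mul_assoc, mul_assoc, h', mul_smul_comm, smul_smul, mul_assoc]

lemma sc_pow {X z : A} {c : K} (h : X * z = c • (z * X)) (k : ℕ) :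
    X * z ^ k = c ^ k • (z ^ k * X) := by
  induction k with
  | zero => simp
  | succ k ih => rw [pow_succ, pow_succ]; exact sc_mul ih h

lemma exists_avg {n : ℕ} (hinv : (n : K) ≠ 0) {X : A} {a : K} (ha : a ≠ 0)
    (hX : X ^ n = algebraMap K A a) :
    ∃ T : A →ₗ[K] A,
      (∀ z (c : K), X * z = c • (z * X) → c ^ n = 1 → c ≠ 1 → T z = 0) ∧
      (∀ z, X * z = z * X → T z = z) ∧
      (∀ (I : TwoSidedIdeal A) z, z ∈ I → T z ∈ I) := by
  let T : A →ₗ[K] A := ((n : K)⁻¹ * a⁻¹) • ∑ k ∈ Finset.range n,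
    (LinearMap.mulLeft K (X ^ k)).comp (LinearMap.mulRight K (X ^ (n - k)))
  have hT : ∀ z, T z = ((n : K)⁻¹ * a⁻¹) • ∑ k ∈ Finset.range n, X ^ k * (z * X ^ (n - k)) := by
    intro z
    simp [T, LinearMap.sum_apply]
  have key : ∀ z (c : K), X * z = c • (z * X) →
      T z = ((n : K)⁻¹ * ∑ k ∈ Finset.range n, c ^ k) • z := by
    intro z c h
    have : ∀ k ∈ Finset.range n, X ^ k * (z * X ^ (n - k)) = (c ^ k * a) • z := by
      intro k hk
      have hk' := Finset.mem_range.mp hk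
      rw [← mul_assoc, sc_pow_left h, smul_mul_assoc, mul_assoc, ← pow_add,
        Nat.add_sub_cancel' hk'.le, hX, ← Algebra.commutes, ← Algebra.smul_def, smul_smul]
    rw [hT, Finset.sum_congr rfl this, ← Finset.sum_smul, smul_smul, ← Finset.sum_mul]
    congr 1
    field_simp
  refine ⟨T, ?_, ?_, ?_⟩
  · intro z c h hc hc1
    rw [key z c h]
    have : (∑ k ∈ Finset.range n, c ^ k) = 0 := by
      have := geom_sum_mul c n
      rw [hc, sub_self] at this
      exact (mul_eq_zero.mp this).resolve_right (sub_ne_zero.mpr hc1)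
    simp [this]
  · intro z h
    rw [key z 1 (by simpa using h)]
    simp [hinv]
  · intro I z hz
    rw [hT, Algebra.smul_def]
    exact I.mul_mem_left _ _ (sum_mem fun k _ => I.mul_mem_left _ _ (I.mul_mem_right _ _ hz))

lemma main {n : ℕ} (hn : 0 < n) {ζ : K} (hζ : IsPrimitiveRoot ζ n) (hinv : (n : K) ≠ 0)
    {a b : K} (ha : a ≠ 0) (hb : b ≠ 0) [Nontrivial A] (X Y : A)
    (hX : X ^ n = algebraMap K A a) (hY : Y ^ n = algebraMap K A b)
    (hXY : X * Y = ζ • (Y * X))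
    (hgen : ∀ W : Submodule K A, 1 ∈ W → (∀ w ∈ W, X * w ∈ W) → (∀ w ∈ W, Y * w ∈ W) → W = ⊤) :
    Algebra.IsCentral K A ∧ IsSimpleRing A ∧ Module.finrank K A = n ^ 2 := by
  have hζ0 : ζ ≠ 0 := hζ.ne_zero hn.ne'
  have hYX : Y * X = ζ⁻¹ • (X * Y) := by rw [hXY, smul_smul, inv_mul_cancel₀ hζ0, one_smul]
  have hζ' : IsPrimitiveRoot ζ⁻¹ n := hζ.inv
  have hXX : X * X = (1 : K) • (X * X) := by simp
  have hYY : Y * Y = (1 : K) • (Y * Y) := by simp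
  let P : Fin n × Fin n → A := fun p => X ^ (p.1 : ℕ) * Y ^ (p.2 : ℕ)
  let Q : Fin n × Fin n → A := fun p => Y ^ (n - (p.2 : ℕ)) * X ^ (n - (p.1 : ℕ))
  -- spanning
  have hspan : Submodule.span K (Set.range P) = ⊤ := by
    have hmem : ∀ i j : ℕ, X ^ i * Y ^ j ∈ Submodule.span K (Set.range P) := by
      intro i j
      have e : X ^ i * Y ^ j = (a ^ (i / n) * b ^ (j / n)) •
          P (⟨i % n, Nat.mod_lt _ hn⟩, ⟨j % n, Nat.mod_lt _ hn⟩) := by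
        have e1 : X ^ i = a ^ (i / n) • X ^ (i % n) := by
          conv_lhs => rw [← Nat.div_add_mod i n, pow_add, pow_mul, hX, ← map_pow,
            ← Algebra.smul_def]
        have e2 : Y ^ j = b ^ (j / n) • Y ^ (j % n) := by
          conv_lhs => rw [← Nat.div_add_mod j n, pow_add, pow_mul, hY, ← map_pow,
            ← Algebra.smul_def]
        rw [e1, e2, smul_mul_smul_comm]
      rw [e]
      exact Submodule.smul_mem _ _ (Submodule.subset_span ⟨_, rfl⟩)
    apply hgen
    · simpa using hmem 0 0
    · intro w hw
      induction hw using Submodule.span_induction with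
      | mem x hx =>
        obtain ⟨p, rfl⟩ := hx
        have := hmem (p.1 + 1) p.2
        rwa [pow_succ', mul_assoc] at this
      | zero => simp
      | add x y _ _ hx hy => rw [mul_add]; exact add_mem hx hy
      | smul c x _ hx => rw [mul_smul_comm]; exact Submodule.smul_mem _ _ hx
    · intro w hw
      induction hw using Submodule.span_induction with
      | mem x hx =>
        obtain ⟨p, rfl⟩ := hx
        have := hmem p.1 (p.2 + 1)
        simp only [P]
        rw [← mul_assoc, sc_pow hYX, smul_mul_assoc, mul_assoc, ← pow_succ']
        exact Submodule.smul_mem _ _ this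
      | zero => simp
      | add x y _ _ hx hy => rw [mul_add]; exact add_mem hx hy
      | smul c x _ hx => rw [mul_smul_comm]; exact Submodule.smul_mem _ _ hx
  obtain ⟨T, T1, T2, T3⟩ := exists_avg hinv ha hX
  obtain ⟨S, S1, S2, S3⟩ := exists_avg hinv hb hY
  have hX' : ∀ p q : Fin n × Fin n,
      X * (P p * Q q) = ζ ^ ((p.2 : ℕ) + (n - q.2)) • ((P p * Q q) * X) := by
    intro p q
    have := sc_mul (sc_mul (sc_pow hXX p.1) (sc_pow hXY p.2))
      (sc_mul (sc_pow hXY (n - q.2)) (sc_pow hXX (n - q.1)))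
    simpa [P, Q, pow_add] using this
  have hY' : ∀ p q : Fin n × Fin n,
      Y * (P p * Q q) = ζ⁻¹ ^ ((p.1 : ℕ) + (n - q.1)) • ((P p * Q q) * Y) := by
    intro p q
    have := sc_mul (sc_mul (sc_pow hYX p.1) (sc_pow hYY p.2))
      (sc_mul (sc_pow hYY (n - q.2)) (sc_pow hYX (n - q.1)))
    simpa only [P, Q, pow_add, one_pow, mul_one, one_mul] using this
  have hne : ∀ {ξ : K}, IsPrimitiveRoot ξ n → ∀ i j : Fin n, i ≠ j →
      ξ ^ ((i : ℕ) + (n - j)) ≠ 1 := by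
    intro ξ hξ i j hij h
    have h1 := hξ.pow_eq_one_iff_dvd _ |>.mp h
    obtain ⟨m, hm⟩ := h1
    have hi := i.2
    have hj := j.2
    apply hij
    apply Fin.ext
    have m1 : m = 1 := by
      have : m < 2 := by
        by_contra hc
        have : n * 2 ≤ n * m := Nat.mul_le_mul_left _ (by omega)
        omega
      have : m ≠ 0 := by rintro rfl; omega
      omega
    subst m1
    omega
  have hdiag : ∀ q, P q * Q q = algebraMap K A (a * b) := by
    intro q
    simp only [P, Q]
    rw [mul_assoc, ← mul_assoc (Y ^ (q.2 : ℕ)), ← pow_add, Nat.add_sub_cancel' q.2.2.le, hY,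
      Algebra.commutes b, ← mul_assoc, ← pow_add, Nat.add_sub_cancel' q.1.2.le, hX, map_mul]
  have hST : ∀ p q, p ≠ q → S (T (P p * Q q)) = 0 := by
    intro p q hpq
    by_cases h2 : p.2 = q.2
    · have h1 : p.1 ≠ q.1 := fun h => hpq (Prod.ext h h2)
      rw [T2]
      · exact S1 _ _ (hY' p q) (by rw [← pow_mul, mul_comm, pow_mul, hζ'.pow_eq_one, one_pow])
          (hne hζ' _ _ h1)
      · have := hX' p q
        rwa [h2, Nat.add_sub_cancel' q.2.2.le, hζ.pow_eq_one, one_smul] at this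
    · rw [T1 _ _ (hX' p q) (by rw [← pow_mul, mul_comm, pow_mul, hζ.pow_eq_one, one_pow])
          (hne hζ _ _ h2), map_zero]
  have hSTc : ∀ c : K, S (T (algebraMap K A c)) = algebraMap K A c := by
    intro c
    rw [T2 _ (Algebra.commutes c X).symm, S2 _ (Algebra.commutes c Y).symm]
  have hcoef : ∀ (c : Fin n × Fin n → K) (q), S (T ((∑ p, c p • P p) * Q q)) =
      algebraMap K A (c q * (a * b)) := by
    intro c q
    rw [Finset.sum_mul, map_sum, map_sum, Finset.sum_eq_single q]
    · rw [smul_mul_assoc, map_smul, map_smul, hdiag, hSTc, Algebra.smul_def, ← map_mul]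
    · intro p _ hp
      rw [smul_mul_assoc, map_smul, map_smul, hST p q hp, smul_zero]
    · simp
  have hrep : ∀ z : A, ∃ c : Fin n × Fin n → K, ∑ p, c p • P p = z := by
    intro z
    have : z ∈ Submodule.span K (Set.range P) := hspan ▸ Submodule.mem_top
    exact (Submodule.mem_span_range_iff_exists_fun K).mp this
  have hab : a * b ≠ 0 := mul_ne_zero ha hb
  refine ⟨⟨?_⟩, ⟨⟨?_⟩⟩, ?_⟩
  · intro z hz
    rw [Subalgebra.mem_center_iff] at hz
    obtain ⟨c, hc⟩ := hrep z
    have hq := hcoef c (⟨0, hn⟩, ⟨0, hn⟩)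
    have hQ : Q (⟨0, hn⟩, ⟨0, hn⟩) = algebraMap K A (a * b) := by
      simp [Q, hX, hY, mul_comm a b]
    rw [hc, hQ, ← Algebra.commutes, ← Algebra.smul_def, map_smul, map_smul, T2 z (hz X),
      S2 z (hz Y), mul_comm (c _), map_mul, ← Algebra.smul_def] at hq
    have := smul_right_injective A hab hq
    rw [Algebra.mem_bot]
    exact ⟨_, this.symm⟩
  · intro I
    by_cases hI : ∃ z ∈ I, z ≠ 0
    · right
      obtain ⟨z, hzI, hz0⟩ := hI
      obtain ⟨c, hc⟩ := hrep z
      have : ∃ q, c q ≠ 0 := by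
        by_contra h
        push Not at h
        apply hz0
        rw [← hc]
        simp [h]
      obtain ⟨q, hq⟩ := this
      have h1 : S (T (z * Q q)) ∈ I := S3 _ _ (T3 _ _ (I.mul_mem_right _ _ hzI))
      rw [← hc, hcoef] at h1
      have h2 := I.mul_mem_left (algebraMap K A (c q * (a * b))⁻¹) _ h1
      rw [← map_mul, inv_mul_cancel₀ (mul_ne_zero hq hab), map_one] at h2
      exact I.one_mem_iff.mp h2
    · left
      push Not at hI
      rw [eq_bot_iff]
      intro z hz
      rw [hI z hz]
      exact zero_mem _
  · have hli : LinearIndependent K P := by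
      rw [Fintype.linearIndependent_iff]
      intro c hc q
      have := hcoef c q
      rw [hc, zero_mul, map_zero, map_zero, eq_comm, map_eq_zero] at this
      exact (mul_eq_zero.mp this).resolve_right hab
    rw [Module.finrank_eq_card_basis (Module.Basis.mk hli hspan.ge)]
    simp [sq]

end

lemma exists_rep {K : Type u} [Field K] {n : ℕ} (hn : 0 < n) {ζ : K} (hζ : ζ ^ n = 1) (a b : K) :
    ∃ (B : Type u) (_ : Ring B) (_ : Algebra K B) (_ : Nontrivial B) (X Y : B),
      X ^ n = algebraMap K B a ∧ Y ^ n = algebraMap K B b ∧ X * Y = ζ • (Y * X) := by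
  have : NeZero n := ⟨hn.ne'⟩
  let L := AlgebraicClosure K
  obtain ⟨α, hα⟩ := IsAlgClosed.exists_pow_nat_eq (algebraMap K L a) hn
  obtain ⟨β, hβ⟩ := IsAlgClosed.exists_pow_nat_eq (algebraMap K L b) hn
  let ψ : AddChar (ZMod n) K := AddChar.zmodChar n hζ
  have hψ1 : ψ 1 = ζ := by
    have := AddChar.zmodChar_apply' hζ 1
    simpa using this
  have hψn : ∀ i, ψ i ^ n = 1 := by
    intro i
    rw [← AddChar.map_nsmul_eq_pow]
    simp
  let X : Module.End K (ZMod n → L) :=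
    { toFun := fun f i => ψ i • (α * f i)
      map_add' := by intro f g; ext i; simp [mul_add]
      map_smul' := by intro c f; ext i; simp [smul_comm c] }
  let Y : Module.End K (ZMod n → L) :=
    { toFun := fun f i => β * f (i - 1)
      map_add' := by intro f g; ext i; simp [mul_add]
      map_smul' := by intro c f; ext i; simp }
  have hXk : ∀ (k : ℕ) f i, (X ^ k) f i = ψ i ^ k • (α ^ k * f i) := by
    intro k
    induction k with
    | zero => simp
    | succ k ih =>
      intro f i
      rw [pow_succ, Module.End.mul_apply, ih]
      simp only [X, LinearMap.coe_mk, AddHom.coe_mk, mul_smul_comm, smul_smul]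
      rw [← pow_succ, pow_succ α, mul_assoc]
  have hYk : ∀ (k : ℕ) f i, (Y ^ k) f i = β ^ k * f (i - k) := by
    intro k
    induction k with
    | zero => simp
    | succ k ih =>
      intro f i
      rw [pow_succ, Module.End.mul_apply, ih]
      simp only [Y, LinearMap.coe_mk, AddHom.coe_mk]
      rw [pow_succ β, mul_assoc, Nat.cast_succ, sub_sub]
  refine ⟨Module.End K (ZMod n → L), inferInstance, inferInstance, inferInstance, X, Y, ?_, ?_, ?_⟩
  · refine LinearMap.ext fun f => ?_
    funext i
    rw [hXk, hψn, hα, one_smul, Module.algebraMap_end_apply, Pi.smul_apply, Algebra.smul_def]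
  · refine LinearMap.ext fun f => ?_
    funext i
    rw [hYk, hβ, Module.algebraMap_end_apply, Pi.smul_apply, Algebra.smul_def]
    simp
  · refine LinearMap.ext fun f => ?_
    funext i
    have : ψ i = ζ * ψ (i - 1) := by
      rw [← hψ1, ← AddChar.map_add_eq_mul]; simp
    simp only [X, Y, LinearMap.coe_mk, AddHom.coe_mk, Module.End.mul_apply, LinearMap.smul_apply,
      Pi.smul_apply, mul_smul_comm, smul_smul]
    rw [this, mul_left_comm]

end SymAux

/-- Let `k ⊆ K` be fields, `ζ ∈ k` a primitive `n`-th root of unity (`n ≥ 2`, `n`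
invertible in `K`), and `a, b ∈ Kˣ`. Then the symbol algebra `(a, b)_{ζ,n}` over `K`
is a central simple `K`-algebra of dimension `n²`. -/
theorem symbolAlgebra_isCentralSimple (k K : Type*) [Field k] [Field K] [Algebra k K]
    (n : ℕ) (hn : 2 ≤ n) (ζ : k) (hζ : IsPrimitiveRoot ζ n) (hinv : (n : K) ≠ 0)
    (a b : Kˣ) :
    Algebra.IsCentral K (SymbolAlgebra K n (algebraMap k K ζ) (a : K) (b : K)) ∧
      IsSimpleRing (SymbolAlgebra K n (algebraMap k K ζ) (a : K) (b : K)) ∧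
      Module.finrank K (SymbolAlgebra K n (algebraMap k K ζ) (a : K) (b : K)) = n ^ 2 := by
  have hn0 : 0 < n := by omega
  have hζ' : IsPrimitiveRoot (algebraMap k K ζ) n := hζ.map_of_injective (algebraMap k K).injective
  generalize algebraMap k K ζ = ξ at hζ'
  let π : FreeAlgebra K (Fin 2) →ₐ[K] SymbolAlgebra K n ξ (a : K) (b : K) :=
    RingQuot.mkAlgHom K (SymbolRel K n ξ (a : K) (b : K))
  have hπ : Function.Surjective π := RingQuot.mkAlgHom_surjective K _
  have hrel : ∀ {u v}, SymbolRel K n ξ (a : K) (b : K) u v → π u = π v :=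
    fun h => RingQuot.mkAlgHom_rel K h
  have hnt : Nontrivial (SymbolAlgebra K n ξ (a : K) (b : K)) := by
    obtain ⟨B, _, _, _, X, Y, hX, hY, hXY⟩ := SymAux.exists_rep hn0 hζ'.pow_eq_one (a : K) (b : K)
    let f : FreeAlgebra K (Fin 2) →ₐ[K] B := FreeAlgebra.lift K ![X, Y]
    have hf : ∀ ⦃u v⦄, SymbolRel K n ξ (a : K) (b : K) u v → f u = f v := by
      intro u v h
      cases h with
      | x_pow => simpa [f] using hX
      | y_pow => simpa [f] using hY
      | comm => simpa [f, Algebra.smul_def] using hXY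
    let g : SymbolAlgebra K n ξ (a : K) (b : K) →ₐ[K] B := RingQuot.liftAlgHom K ⟨f, hf⟩
    exact g.toRingHom.domain_nontrivial
  refine SymAux.main hn0 hζ' hinv a.ne_zero b.ne_zero (π (ι K 0)) (π (ι K 1)) ?_ ?_ ?_ ?_
  · rw [← map_pow, hrel SymbolRel.x_pow, AlgHom.commutes]
  · rw [← map_pow, hrel SymbolRel.y_pow, AlgHom.commutes]
  · rw [← map_mul, hrel SymbolRel.comm, map_mul, AlgHom.commutes, ← Algebra.smul_def, map_mul]
  · intro W h1 hX hY
    have key : ∀ u : FreeAlgebra K (Fin 2), ∀ w ∈ W, π u * w ∈ W := by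
      intro u
      induction u using FreeAlgebra.induction with
      | grade0 r =>
        intro w hw
        rw [AlgHom.commutes, ← Algebra.smul_def]
        exact W.smul_mem _ hw
      | grade1 x =>
        fin_cases x
        · exact hX
        · exact hY
      | mul u v hu hv =>
        intro w hw
        rw [map_mul, mul_assoc]
        exact hu _ (hv _ hw)
      | add u v hu hv =>
        intro w hw
        rw [map_add, add_mul]
        exact add_mem (hu _ hw) (hv _ hw)
    rw [eq_top_iff]
    intro z _
    obtain ⟨u, rfl⟩ := hπ z
    simpa using key u 1 h1
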